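/- Let n ≥ 2 and let k : {1,…,n} → {2,3,…} be given by k(1) = k(2) = 3 and k(d) = 5 for 3 ≤ d ≤ n. Then there exists a group homomorphism ρ : W(n,k) → ℤ/4ℤ such that ρ(s_{i,1}) = 1, ρ(s_{i,d}) = 0 for all d ≠ 1, and ρ(τ_i) = 2, for all i ∈ ℕ. In particular, ρ(s_{1,d}^{-1} s_{1,1}) = 1 for d ≠ 1 (when k(d) = 3) up to sign, and ρ(s_{1,d}^{-1} τ_1 s_{1,d}) = 2 for all d. -/

import Mathlib

namespace WGroup

/-- The space `Z(n,k) × ℕ`, where `Z(n,k) = C_{k(1)} × ⋯ × C_{k(n)}` is the product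
of Cantor spaces and the second factor indexes the copies.  (Indices are taken in
Lean's `ℕ`, i.e. starting from `0` rather than `1`.) -/
abbrev Sp (n : ℕ) (k : Fin n → ℕ) : Type := (∀ d : Fin n, ℕ → Fin (k d)) × ℕ

/-- The defining formula for the generator `s_{i,d}`:
`s_{i,d}(z,j) = (z,j)` for `j < i`; `s_{i,d}(z,i) = (σ_d(z), i + z^{(d)}_1)`; and
`s_{i,d}(z,j) = (z, j + k(d) - 1)` for `j > i`. -/
def sMap {n : ℕ} (k : Fin n → ℕ) (i : ℕ) (d : Fin n) (p : Sp n k) : Sp n k :=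
  if p.2 < i then p
  else if p.2 = i then
    (Function.update p.1 d (fun m => p.1 d (m + 1)), i + (p.1 d 0 : ℕ))
  else (p.1, p.2 + (k d - 1))

/-- The defining formula for the generator `τ_i`: it interchanges `(z,i)` and
`(z,i+1)` and fixes all other points. -/
def tMap {n : ℕ} (k : Fin n → ℕ) (i : ℕ) (p : Sp n k) : Sp n k :=
  if p.2 = i then (p.1, i + 1)
  else if p.2 = i + 1 then (p.1, i)
  else p

/-- The generating set `{s_{i,d}, τ_i : i ∈ ℕ, 1 ≤ d ≤ n}` of `W(n,k)`. -/
def gens {n : ℕ} (k : Fin n → ℕ) (s : ℕ → Fin n → Equiv.Perm (Sp n k))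
    (t : ℕ → Equiv.Perm (Sp n k)) : Set (Equiv.Perm (Sp n k)) :=
  {g | ∃ i d, g = s i d} ∪ {g | ∃ i, g = t i}

end WGroup

/-- The arity function for STATEMENT 10: `k(1) = k(2) = 3` and `k(d) = 5` for `d ≥ 3`
(with `0`-based indexing: `k 0 = k 1 = 3`, `k d = 5` otherwise). -/
def kTen (n : ℕ) : Fin n → ℕ := fun d => if (d : ℕ) < 2 then 3 else 5

namespace WGroup

/-- A point of `Z(n,k)`. -/
abbrev Cfg {n : ℕ} (k : Fin n → ℕ) : Type := ∀ d : Fin n, ℕ → Fin (k d)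

section BrickMaps

variable {n : ℕ} {k : Fin n → ℕ}

/-- Prepend, in each direction `d`, the first `p d` letters of `w d`. -/
def pre (p : Fin n → ℕ) (w z : Cfg k) : Cfg k :=
  fun d t => if t < p d then w d t else z d (t - p d)

/-- Prepend the letter `a` in direction `d`. -/
def cons (d : Fin n) (a : Fin (k d)) (z : Cfg k) : Cfg k :=
  Function.update z d (fun t => if t = 0 then a else z d (t - 1))

lemma pre_cons (p : Fin n → ℕ) (w z : Cfg k) (d : Fin n) (a : Fin (k d)) :
    pre p w (cons d a z) =
      pre (Function.update p d (p d + 1))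
        (Function.update w d (Function.update (w d) (p d) a)) z := by
  funext e t
  rcases eq_or_ne e d with rfl | he
  · simp only [pre, cons, Function.update_self]
    rcases lt_trichotomy t (p e) with h | rfl | h
    · rw [if_pos h, if_pos (by omega), Function.update_of_ne h.ne]
    · simp
    · rw [if_neg (by omega), if_neg (by omega), if_neg (by omega)]
      congr 1
  · simp [pre, cons, Function.update_of_ne he]

/-- `m` carries a brick canonically onto each copy `Z × {i}`, and `p i d` is the depth of that
brick in direction `d`. -/
def IsBrickMap (m : Equiv.Perm (Sp n k)) (p : ℕ → Fin n → ℕ) : Prop :=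
  ∀ i, ∃ (j : ℕ) (w : Cfg k), ∀ z, m.symm (z, i) = (pre (p i) w z, j)

lemma IsBrickMap.depth_le (hk : ∀ d, 2 ≤ k d) {m : Equiv.Perm (Sp n k)}
    {p p' : ℕ → Fin n → ℕ} (h : IsBrickMap m p) (h' : IsBrickMap m p') (i : ℕ) (d : Fin n) :
    p' i d ≤ p i d := by
  by_contra! hlt
  obtain ⟨j, w, hw⟩ := h i
  obtain ⟨j', w', hw'⟩ := h' i
  have key : ∀ z : Cfg k, z d 0 = w' d (p i d) := by
    intro z
    have := congrFun (congrFun (congrArg Prod.fst ((hw z).symm.trans (hw' z))) d) (p i d)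
    simpa [pre, hlt] using this
  have h0 := key (fun e _ => ⟨0, by have := hk e; omega⟩)
  have h1 := key (fun e _ => ⟨1, by have := hk e; omega⟩)
  have := h0.trans h1.symm
  simp at this

lemma IsBrickMap.unique (hk : ∀ d, 2 ≤ k d) {m : Equiv.Perm (Sp n k)}
    {p p' : ℕ → Fin n → ℕ} (h : IsBrickMap m p) (h' : IsBrickMap m p') : p = p' :=
  funext fun i => funext fun d => le_antisymm (h'.depth_le hk h i d) (h.depth_le hk h' i d)

lemma isBrickMap_one [∀ d, NeZero (k d)] :
    IsBrickMap (1 : Equiv.Perm (Sp n k)) (fun _ _ => 0) :=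
  fun i => ⟨i, fun _ _ => 0, fun _ => rfl⟩

/-- The depths of the bricks after splitting the brick with label `i` in direction `d`. -/
def splitDepth (k : Fin n → ℕ) (i : ℕ) (d : Fin n) (p : ℕ → Fin n → ℕ) : ℕ → Fin n → ℕ :=
  fun l => if l < i then p l else if l < i + k d then Function.update (p i) d (p i d + 1)
    else p (l - (k d - 1))

variable {g : Equiv.Perm (Sp n k)} {i : ℕ} {d : Fin n}

lemma split_symm_of_lt (hg : ∀ x, g x = sMap k i d x) (z : Cfg k) {l : ℕ} (h : l < i) :
    g.symm (z, l) = (z, l) := by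
  rw [Equiv.symm_apply_eq, hg, sMap, if_pos h]

lemma split_symm_of_ge (hg : ∀ x, g x = sMap k i d x) (z : Cfg k) {l : ℕ} (hd : 1 ≤ k d)
    (h : i + k d ≤ l) : g.symm (z, l) = (z, l - (k d - 1)) := by
  rw [Equiv.symm_apply_eq, hg, sMap, if_neg (by simp only; omega), if_neg (by simp only; omega)]
  simp only [Prod.mk.injEq, true_and]
  omega

lemma split_symm_add (hg : ∀ x, g x = sMap k i d x) (z : Cfg k) (a : Fin (k d)) :
    g.symm (z, i + a) = (cons d a z, i) := by
  rw [Equiv.symm_apply_eq, hg, sMap, if_neg (by simp), if_pos rfl]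
  simp only [cons, Function.update_self, Prod.mk.injEq]
  refine ⟨?_, by simp⟩
  funext e t
  rcases eq_or_ne e d with rfl | he
  · simp
  · simp [Function.update_of_ne he]

lemma IsBrickMap.split (hd : 1 ≤ k d) (hg : ∀ x, g x = sMap k i d x)
    {m : Equiv.Perm (Sp n k)} {p : ℕ → Fin n → ℕ} (h : IsBrickMap m p) :
    IsBrickMap (g * m) (splitDepth k i d p) := by
  intro l
  have hs : ∀ x, (g * m).symm x = m.symm (g.symm x) := fun _ => rfl
  simp only [hs]
  rcases lt_or_ge l i with hl | hl
  · obtain ⟨j, w, hw⟩ := h l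
    exact ⟨j, w, fun z => by rw [split_symm_of_lt hg z hl, hw, splitDepth, if_pos hl]⟩
  rcases lt_or_ge l (i + k d) with hl' | hl'
  · obtain ⟨j, w, hw⟩ := h i
    obtain ⟨a, rfl⟩ : ∃ a : Fin (k d), l = i + a := ⟨⟨l - i, by omega⟩, by simp; omega⟩
    exact ⟨j, _, fun z => by
      rw [split_symm_add hg z a, hw, pre_cons, splitDepth, if_neg (by omega), if_pos hl']⟩
  · obtain ⟨j, w, hw⟩ := h (l - (k d - 1))
    exact ⟨j, w, fun z => by
      rw [split_symm_of_ge hg z hd hl', hw, splitDepth, if_neg (by omega), if_neg (by omega)]⟩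

lemma splitDepth_apply (hd : 1 ≤ k d) (hg : ∀ x, g x = sMap k i d x) (p : ℕ → Fin n → ℕ)
    (u : Sp n k) : splitDepth k i d p (g u).2 =
      if u.2 = i then Function.update (p i) d (p i d + 1) else p u.2 := by
  rcases lt_trichotomy u.2 i with h | h | h
  · have hu : g u = u := by rw [hg, sMap, if_pos h]
    rw [hu, splitDepth, if_pos h, if_neg h.ne]
  · have hu : (g u).2 = i + (u.1 d 0 : ℕ) := by rw [hg, sMap, if_neg (by omega), if_pos h]
    have := (u.1 d 0).2
    rw [hu, splitDepth, if_neg (by omega), if_pos (by omega), if_pos h]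
  · have hu : (g u).2 = u.2 + (k d - 1) := by rw [hg, sMap, if_neg (by omega), if_neg (by omega)]
    rw [hu, splitDepth, if_neg (by omega), if_neg (by omega), if_neg (by omega),
      Nat.add_sub_cancel]

lemma swap_symm (hg : ∀ x, g x = tMap k i x) : g.symm = g := by
  ext1 x
  rw [Equiv.symm_apply_eq, hg, hg]
  obtain ⟨z, l⟩ := x
  simp only [tMap]
  split_ifs <;> simp_all

lemma swap_apply (hg : ∀ x, g x = tMap k i x) (x : Sp n k) :
    g x = (x.1, Equiv.swap i (i + 1) x.2) := by
  rw [hg, tMap, Equiv.swap_apply_def]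
  split_ifs <;> rfl

lemma IsBrickMap.swap (hg : ∀ x, g x = tMap k i x) {m : Equiv.Perm (Sp n k)}
    {p : ℕ → Fin n → ℕ} (h : IsBrickMap m p) :
    IsBrickMap (g * m) (fun l => p (Equiv.swap i (i + 1) l)) := by
  intro l
  obtain ⟨j, w, hw⟩ := h (Equiv.swap i (i + 1) l)
  refine ⟨j, w, fun z => ?_⟩
  change m.symm (g.symm (z, l)) = _
  rw [swap_symm hg, swap_apply hg, hw]

/-- `m` moves the copies from the `J`-th onwards to those from the `L`-th onwards by a shift. -/
def IsShiftFrom (m : Equiv.Perm (Sp n k)) (J L : ℕ) : Prop :=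
  ∀ z j, m (z, J + j) = (z, L + j)

lemma IsShiftFrom.mono {m : Equiv.Perm (Sp n k)} {J L : ℕ} (h : IsShiftFrom m J L) (r : ℕ) :
    IsShiftFrom m (J + r) (L + r) := by
  intro z j
  rw [add_assoc, h, add_assoc]

lemma IsShiftFrom.symm_lt_iff {m : Equiv.Perm (Sp n k)} {J L : ℕ} (h : IsShiftFrom m J L)
    (z : Cfg k) (l : ℕ) : (m.symm (z, l)).2 < J ↔ l < L := by
  constructor
  · intro hlt
    by_contra! hl
    obtain ⟨j, rfl⟩ := Nat.exists_eq_add_of_le hl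
    rw [← h z j, Equiv.symm_apply_apply] at hlt
    simp at hlt
  · intro hl
    by_contra! hJ
    obtain ⟨j, hj⟩ := Nat.exists_eq_add_of_le hJ
    have := h (m.symm (z, l)).1 j
    rw [← hj, Prod.mk.eta, Equiv.apply_symm_apply] at this
    have := congrArg Prod.snd this
    simp only at this
    omega

lemma IsShiftFrom.split (hg : ∀ x, g x = sMap k i d x)
    {m : Equiv.Perm (Sp n k)} {J L : ℕ} (h : IsShiftFrom m J L) (hi : i < L) :
    IsShiftFrom (g * m) J (L + (k d - 1)) := by
  intro z j
  rw [Equiv.Perm.mul_apply, h, hg, sMap, if_neg (by simp only; omega),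
    if_neg (by simp only; omega)]
  simp only [Prod.mk.injEq, true_and]
  omega

lemma IsShiftFrom.swap (hg : ∀ x, g x = tMap k i x)
    {m : Equiv.Perm (Sp n k)} {J L : ℕ} (h : IsShiftFrom m J L) (hi : i + 1 < L) :
    IsShiftFrom (g * m) J L := by
  intro z j
  rw [Equiv.Perm.mul_apply, h, hg, tMap, if_neg (by simp only; omega),
    if_neg (by simp only; omega)]

end BrickMaps

section Grids

variable {n : ℕ} {k : Fin n → ℕ} [∀ d, NeZero (k d)]

open Classical in
/-- The points of `Z(n,k)` whose `d`-th coordinate vanishes from the index `q d` onwards. -/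
noncomputable def grid (k : Fin n → ℕ) [∀ d, NeZero (k d)] (q : Fin n → ℕ) : Finset (Cfg k) :=
  Finset.univ.image fun (x : ∀ d, Fin (q d) → Fin (k d)) d t =>
    if h : t < q d then x d ⟨t, h⟩ else 0

lemma mem_grid {q : Fin n → ℕ} {z : Cfg k} :
    z ∈ grid k q ↔ ∀ d t, q d ≤ t → z d t = 0 := by
  simp only [grid, Finset.mem_image, Finset.mem_univ, true_and]
  constructor
  · rintro ⟨x, rfl⟩ d t h
    simp [h]
  · intro h
    refine ⟨fun d t => z d t, ?_⟩
    funext d t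
    by_cases ht : t < q d
    · simp [ht]
    · simp [ht, h d t (by omega)]

lemma card_grid (q : Fin n → ℕ) : (grid k q).card = ∏ d, k d ^ q d := by
  classical
  rw [grid, Finset.card_image_of_injective]
  · simp
  · intro x y h
    funext d t
    simpa using congrFun (congrFun h d) t

/-- The grid of depth `N` in each of the first `J` copies of `Z(n,k)`. -/
noncomputable def box (k : Fin n → ℕ) [∀ d, NeZero (k d)] (N J : ℕ) : Finset (Sp n k) :=
  grid k (fun _ => N) ×ˢ Finset.range J

lemma symm_mem_box {m : Equiv.Perm (Sp n k)} {p : ℕ → Fin n → ℕ} {J L N i : ℕ}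
    (hp : IsBrickMap m p) (hm : IsShiftFrom m J L) (hi : i < L) (hN : ∀ d, p i d ≤ N)
    (z : Cfg k) : m.symm (z, i) ∈ box k N J ↔ z ∈ grid k (fun d => N - p i d) := by
  have hJ := (hm.symm_lt_iff z i).2 hi
  obtain ⟨j, w, hw⟩ := hp i
  rw [hw] at hJ ⊢
  simp only [box, Finset.mem_product, Finset.mem_range, mem_grid]
  constructor
  · rintro ⟨h, -⟩ d t ht
    have := h d (t + p i d) (by omega)
    simpa [pre] using this
  · refine fun h => ⟨fun d t ht => ?_, hJ⟩
    have := hN d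
    rw [pre, if_neg (by omega)]
    exact h d _ (by omega)

open Classical in
lemma card_filter_label {m : Equiv.Perm (Sp n k)} {p : ℕ → Fin n → ℕ} {J L N i : ℕ}
    (hp : IsBrickMap m p) (hm : IsShiftFrom m J L) (hi : i < L) (hN : ∀ d, p i d ≤ N) :
    ((box k N J).filter fun x => (m x).2 = i).card = (grid k fun d => N - p i d).card := by
  symm
  refine Finset.card_bij' (fun z _ => m.symm (z, i)) (fun x _ => (m x).1) ?_ ?_ ?_ ?_
  · intro z hz
    simpa [symm_mem_box hp hm hi hN] using hz
  · intro x hx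
    rw [Finset.mem_filter] at hx
    rw [← symm_mem_box hp hm hi hN, ← hx.2]
    simpa using hx.1
  · simp
  · intro x hx
    rw [Finset.mem_filter] at hx
    simp [← hx.2]

open Classical in
lemma card_filter_label_pair {m : Equiv.Perm (Sp n k)} {p : ℕ → Fin n → ℕ} {J L N i i' : ℕ}
    (hp : IsBrickMap m p) (hm : IsShiftFrom m J L) (hi : i < L) (hN : ∀ d, p i d ≤ N)
    (hi' : i' < L) (hN' : ∀ d, p i' d ≤ N) (P : Cfg k → Cfg k → Prop) :
    ((box k N J ×ˢ box k N J).filter fun x =>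
        (m x.1).2 = i ∧ (m x.2).2 = i' ∧ P (m x.1).1 (m x.2).1).card =
      (((grid k fun d => N - p i d) ×ˢ (grid k fun d => N - p i' d)).filter
        fun z => P z.1 z.2).card := by
  symm
  refine Finset.card_bij' (fun z _ => (m.symm (z.1, i), m.symm (z.2, i')))
    (fun x _ => ((m x.1).1, (m x.2).1)) ?_ ?_ ?_ ?_
  · intro z hz
    simpa [symm_mem_box hp hm hi hN, symm_mem_box hp hm hi' hN'] using hz
  · intro x hx
    simp only [Finset.mem_filter, Finset.mem_product] at hx ⊢
    obtain ⟨⟨h1, h2⟩, e1, e2, h3⟩ := hx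
    rw [← symm_mem_box hp hm hi hN, ← symm_mem_box hp hm hi' hN', ← e1, ← e2]
    simpa [h1, h2] using h3
  · simp
  · intro x hx
    simp only [Finset.mem_filter, Finset.mem_product] at hx
    obtain ⟨-, e1, e2, -⟩ := hx
    simp [← e1, ← e2]

/-- The points of a grid whose first letter in direction `d` is `0` make up a `k d`-th of it. -/
lemma card_grid_filter_zero (q : Fin n → ℕ) (d : Fin n) (hd : 1 ≤ q d) :
    k d * ((grid k q).filter fun z => z d 0 = 0).card = (grid k q).card := by
  trans ((Finset.univ : Finset (Fin (k d))) ×ˢ ((grid k q).filter fun z => z d 0 = 0)).card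
  · simp
  refine Finset.card_bij'
    (fun x _ => Function.update x.2 d (Function.update (x.2 d) 0 x.1))
    (fun z _ => (z d 0, Function.update z d (Function.update (z d) 0 0))) ?_ ?_ ?_ ?_
  · rintro ⟨a, z⟩ hz
    simp only [Finset.mem_product, Finset.mem_filter, mem_grid] at hz ⊢
    intro e t ht
    rcases eq_or_ne e d with rfl | he
    · rw [Function.update_self, Function.update_of_ne (by omega)]
      exact hz.2.1 e t ht
    · rw [Function.update_of_ne he]
      exact hz.2.1 e t ht
  · intro z hz
    simp only [Finset.mem_product, Finset.mem_filter, mem_grid] at hz ⊢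
    refine ⟨Finset.mem_univ _, fun e t ht => ?_, by simp⟩
    rcases eq_or_ne e d with rfl | he
    · rw [Function.update_self, Function.update_of_ne (by omega)]
      exact hz e t ht
    · rw [Function.update_of_ne he]
      exact hz e t ht
  · rintro ⟨a, z⟩ hz
    simp only [Finset.mem_product, Finset.mem_filter] at hz
    simp [← hz.2.2]
  · intro z hz
    simp

/-- The lexicographic order on `Z(n,k)`. -/
def ZLt (x y : Cfg k) : Prop :=
  Pi.Lex (· < ·) (Pi.Lex (· < ·) (· < ·)) x y

/-- The lexicographic order on `Z(n,k) × ℕ`, the copies being compared first. -/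
def SpLt (u v : Sp n k) : Prop := u.2 < v.2 ∨ u.2 = v.2 ∧ ZLt u.1 v.1

end Grids

section Counting

variable {n : ℕ} {k : Fin n → ℕ} [∀ d, NeZero (k d)]

/-- `x` precedes `y` lexicographically, as seen from the directions before `d`. -/
def ZLtBefore (d : Fin n) (x y : Cfg k) : Prop :=
  ∃ e < d, (∀ e' < e, x e' = y e') ∧ Pi.Lex (· < ·) (· < ·) (x e) (y e)

omit [∀ d, NeZero (k d)] in
lemma zLt_and_lt_iff (d : Fin n) (x y : Cfg k) :
    (ZLt x y ∧ y d 0 < x d 0) ↔ (ZLtBefore d x y ∧ y d 0 < x d 0) := by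
  refine and_congr_left fun h => ⟨?_, ?_⟩
  · rintro ⟨e, he, hlt⟩
    refine ⟨e, ?_, he, hlt⟩
    by_contra! hde
    rcases hde.lt_or_eq with hde | rfl
    · rw [he d hde] at h
      exact lt_irrefl _ h
    · obtain ⟨t, ht, hlt⟩ := hlt
      rcases Nat.eq_zero_or_pos t with rfl | h0
      · exact lt_asymm h hlt
      · rw [ht 0 h0] at h
        exact lt_irrefl _ h
  · rintro ⟨e, -, he, hlt⟩
    exact ⟨e, he, hlt⟩

omit [∀ d, NeZero (k d)] in
lemma zLtBefore_update (d : Fin n) (x y : Cfg k) (a b : ℕ → Fin (k d)) :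
    ZLtBefore d (Function.update x d a) (Function.update y d b) ↔ ZLtBefore d x y := by
  refine exists_congr fun e => and_congr_right fun he => and_congr ?_ ?_
  · refine forall_congr' fun e' => imp_congr_right fun he' => ?_
    rw [Function.update_of_ne (he'.trans he).ne, Function.update_of_ne (he'.trans he).ne]
  · rw [Function.update_of_ne he.ne, Function.update_of_ne he.ne]

lemma update_first_mem_grid {q : Fin n → ℕ} {d : Fin n} (hd : 1 ≤ q d) {z : Cfg k}
    (hz : z ∈ grid k q) (a : Fin (k d)) :
    Function.update z d (Function.update (z d) 0 a) ∈ grid k q := by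
  rw [mem_grid] at hz ⊢
  intro e t ht
  rcases eq_or_ne e d with rfl | he
  · rw [Function.update_self, Function.update_of_ne (by omega)]
    exact hz e t ht
  · rw [Function.update_of_ne he]
    exact hz e t ht

open Classical in
/-- The number of pairs of points of a grid that are put in the opposite order when the grid is
split in direction `d`. -/
noncomputable def splitInv (k : Fin n → ℕ) [∀ d, NeZero (k d)] (q : Fin n → ℕ) (d : Fin n) : ℕ :=
  ((grid k q ×ˢ grid k q).filter fun z => ZLt z.1 z.2 ∧ z.2 d 0 < z.1 d 0).card

open Classical in
lemma splitInv_eq (q : Fin n → ℕ) (d : Fin n) (hd : 1 ≤ q d) :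
    splitInv k q d = (k d).choose 2 *
      (((grid k q).filter (fun z => z d 0 = 0) ×ˢ (grid k q).filter (fun z => z d 0 = 0)).filter
        fun z => ZLtBefore d z.1 z.2).card := by
  have hpairs : ((Finset.univ : Finset (Fin (k d) × Fin (k d))).filter
      fun a => a.1 < a.2).card = (k d).choose 2 := by
    convert Fintype.card_product_filter_lt (α := Fin (k d))
    rw [Fintype.card_fin]
  rw [← hpairs, ← Finset.card_product, splitInv]
  refine Finset.card_bij'
    (fun z _ => ((z.2 d 0, z.1 d 0),
      (Function.update z.1 d (Function.update (z.1 d) 0 0),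
        Function.update z.2 d (Function.update (z.2 d) 0 0))))
    (fun x _ => (Function.update x.2.1 d (Function.update (x.2.1 d) 0 x.1.2),
      Function.update x.2.2 d (Function.update (x.2.2 d) 0 x.1.1))) ?_ ?_ ?_ ?_
  · intro z hz
    simp only [Finset.mem_product, Finset.mem_filter, zLt_and_lt_iff] at hz
    simp [zLtBefore_update, hz, update_first_mem_grid hd]
  · intro x hx
    simp only [Finset.mem_product, Finset.mem_filter] at hx
    simp [zLt_and_lt_iff, zLtBefore_update, hx, update_first_mem_grid hd]
  · intro z hz
    simp
  · rintro ⟨⟨a, b⟩, x, y⟩ hx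
    simp only [Finset.mem_product, Finset.mem_filter] at hx
    have h1 : Function.update (x d) 0 0 = x d := by rw [← hx.2.1.1.2, Function.update_eq_self]
    have h2 : Function.update (y d) 0 0 = y d := by rw [← hx.2.1.2.2, Function.update_eq_self]
    simp [h1, h2]

lemma neg_one_pow_sub_of_even {N a : ℕ} (hN : Even N) (h : a ≤ N) :
    (-1 : ZMod 4) ^ (N - a) = (-1) ^ a := by
  obtain ⟨b, rfl⟩ := Nat.exists_eq_add_of_le h
  rw [Nat.add_sub_cancel_left]
  have := Nat.even_add.1 hN
  by_cases ha : Even a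
  · rw [ha.neg_one_pow, (this.1 ha).neg_one_pow]
  · rw [(Nat.not_even_iff_odd.1 ha).neg_one_pow,
      (Nat.not_even_iff_odd.1 (mt this.2 ha)).neg_one_pow]

variable {d₀ d₁ : Fin n}

lemma card_grid_cast (h01 : d₀ ≠ d₁) (hk₀ : k d₀ = 3) (hk₁ : k d₁ = 3)
    (hk : ∀ d, d ≠ d₀ → d ≠ d₁ → k d = 5) (q : Fin n → ℕ) :
    ((grid k q).card : ZMod 4) = (-1) ^ (q d₀ + q d₁) := by
  have h (d : Fin n) : (k d : ZMod 4) ^ q d =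
      (if d = d₀ then (-1) ^ q d₀ else 1) * (if d = d₁ then (-1) ^ q d₁ else 1) := by
    have h3 : (3 : ZMod 4) = -1 := by decide
    have h5 : (5 : ZMod 4) = 1 := by decide
    by_cases e0 : d = d₀
    · subst e0
      simp [hk₀, h01, h3]
    · by_cases e1 : d = d₁
      · subst e1
        simp [hk₁, e0, h3]
      · simp [e0, e1, hk d e0 e1, h5]
  rw [card_grid, Nat.cast_prod]
  simp only [Nat.cast_pow, h, Finset.prod_mul_distrib]
  simp [pow_add]

open Classical in
/-- Counting ordered pairs of points by their first coordinate. -/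
lemma two_mul_card_zLt_fst (h01 : d₀ ≠ d₁) (q : Fin n → ℕ) :
    2 * (((grid k q).filter (fun z => z d₁ 0 = 0) ×ˢ
        (grid k q).filter (fun z => z d₁ 0 = 0)).filter
          fun z => Pi.Lex (· < ·) (· < ·) (z.1 d₀) (z.2 d₀)).card +
      ((grid k q).filter (fun z => z d₁ 0 = 0)).card *
        ((grid k (Function.update q d₀ 0)).filter (fun z => z d₁ 0 = 0)).card =
      ((grid k q).filter (fun z => z d₁ 0 = 0)).card *
        ((grid k q).filter (fun z => z d₁ 0 = 0)).card := by
  set H := (grid k q).filter fun z => z d₁ 0 = 0 with hH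
  let R : (ℕ → Fin (k d₀)) → (ℕ → Fin (k d₀)) → Prop := Pi.Lex (· < ·) (· < ·)
  change 2 * ((H ×ˢ H).filter fun z => R (z.1 d₀) (z.2 d₀)).card + _ = _
  have hswap : ((H ×ˢ H).filter fun z => R (z.1 d₀) (z.2 d₀)).card =
      ((H ×ˢ H).filter fun z => R (z.2 d₀) (z.1 d₀)).card := by
    refine Finset.card_bij' (fun z _ => z.swap) (fun z _ => z.swap) ?_ ?_ ?_ ?_ <;>
      simp +contextual
  have hdiag : ((H ×ˢ H).filter fun z => z.1 d₀ = z.2 d₀).card =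
      H.card * ((grid k (Function.update q d₀ 0)).filter (fun z => z d₁ 0 = 0)).card := by
    rw [← Finset.card_product]
    refine Finset.card_bij' (fun z _ => (z.1, Function.update z.2 d₀ 0))
      (fun z _ => (z.1, Function.update z.2 d₀ (z.1 d₀))) ?_ ?_ ?_ ?_
    · rintro ⟨x, y⟩ hz
      simp only [hH, Finset.mem_product, Finset.mem_filter, mem_grid] at hz ⊢
      refine ⟨hz.1.1, fun e t ht => ?_, by simp [h01.symm, hz]⟩
      rcases eq_or_ne e d₀ with rfl | he
      · simp
      · rw [Function.update_of_ne he] at ht ⊢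
        exact hz.1.2.1 e t ht
    · rintro ⟨x, y⟩ hz
      simp only [hH, Finset.mem_product, Finset.mem_filter, mem_grid] at hz ⊢
      refine ⟨⟨hz.1, fun e t ht => ?_, by simp [h01.symm, hz]⟩, by simp⟩
      rcases eq_or_ne e d₀ with rfl | he
      · rw [Function.update_self]
        exact hz.1.1 e t ht
      · rw [Function.update_of_ne he]
        exact hz.2.1 e t (by rwa [Function.update_of_ne he])
    · rintro ⟨x, y⟩ hz
      simp only [Finset.mem_filter] at hz
      simp [hz.2]
    · rintro ⟨x, y⟩ hz
      simp only [hH, Finset.mem_product, Finset.mem_filter, mem_grid] at hz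
      have : y d₀ = 0 := funext fun t => hz.2.1 d₀ t (by simp)
      simp [← this]
  have htri : ∀ a b, R a b ∨ a = b ∨ R b a := by
    exact fun a b => lt_trichotomy (toLex a) (toLex b)
  have hasymm : ∀ a b, R a b → ¬ R b a := by
    exact fun a b => lt_asymm (a := toLex a) (b := toLex b)
  have hirr : ∀ a, ¬ R a a := fun a h => hasymm a a h h
  rw [← hdiag, two_mul]
  nth_rewrite 2 [hswap]
  rw [← Finset.card_union_of_disjoint, ← Finset.card_union_of_disjoint, ← Finset.card_product H H,
    ← Finset.filter_or, ← Finset.filter_or, Finset.filter_true_of_mem]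
  · intro z _
    have := htri (z.1 d₀) (z.2 d₀)
    tauto
  · rw [← Finset.filter_or, Finset.disjoint_filter]
    rintro z - (h | h) e
    · exact hirr _ (e ▸ h)
    · exact hirr _ (e ▸ h)
  · rw [Finset.disjoint_filter]
    exact fun z _ h => hasymm _ _ h

lemma two_mul_splitInv (h₀ : (d₀ : ℕ) = 0) (h₁ : (d₁ : ℕ) = 1) (hk₀ : k d₀ = 3)
    (hk₁ : k d₁ = 3) (hk : ∀ d, d ≠ d₀ → d ≠ d₁ → k d = 5) (q : Fin n → ℕ) (d : Fin n)
    (hd : 1 ≤ q d) :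
    (2 * splitInv k q d : ZMod 4) = if d = d₁ then 1 - (-1) ^ q d₀ else 0 := by
  classical
  have h01 : d₀ ≠ d₁ := by
    rintro rfl
    omega
  rw [splitInv_eq q d hd]
  split_ifs with e1
  · subst e1
    have hbefore : ∀ x y : Cfg k, ZLtBefore d x y ↔ Pi.Lex (· < ·) (· < ·) (x d₀) (y d₀) := by
      intro x y
      constructor
      · rintro ⟨e, he, -, h⟩
        obtain rfl : e = d₀ := Fin.ext (by have : (e : ℕ) < d := he; omega)
        exact h
      · intro h
        exact ⟨d₀, Fin.lt_def.2 (by omega),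
          fun e he => absurd (Fin.lt_def.1 he) (by omega), h⟩
    simp only [hbefore]
    have hcount := two_mul_card_zLt_fst (k := k) h01 q
    have hH := card_grid_filter_zero (k := k) q d hd
    have hH' := card_grid_filter_zero (k := k) (Function.update q d₀ 0) d
      (by rwa [Function.update_of_ne h01.symm])
    revert hcount hH hH'
    generalize (Finset.card _) = C
    generalize (Finset.card _) = H
    generalize ((grid k (Function.update q d₀ 0)).filter (fun z => z d 0 = 0)).card = H'
    intro hcount hH hH'
    apply_fun (Nat.cast : ℕ → ZMod 4) at hcount hH hH'
    rw [card_grid_cast h01 hk₀ hk₁ hk] at hH hH'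
    rw [hk₁] at *
    simp only [Function.update_self, Function.update_of_ne h01.symm, zero_add] at hH'
    rw [pow_add] at hH
    push_cast at *
    have c3 : ((Nat.choose 3 2 : ℕ) : ZMod 4) = 3 := by decide
    rw [c3]
    generalize (C : ZMod 4) = C, (H : ZMod 4) = H, (H' : ZMod 4) = H' at *
    rcases neg_one_pow_eq_or (ZMod 4) (q d₀) with e | e <;>
    rcases neg_one_pow_eq_or (ZMod 4) (q d) with e' | e' <;>
    rw [e'] at hH' <;> rw [e, e'] at hH <;> rw [e] <;> clear e e' <;> revert C H H' <;> decide
  · by_cases e0 : d = d₀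
    · subst e0
      rw [Finset.filter_false_of_mem]
      · simp
      · rintro x - ⟨e, he, -⟩
        have : (e : ℕ) < d := he
        omega
    · have c5 : (((k d).choose 2 : ℕ) : ZMod 4) = 2 := by
        rw [hk d e0 e1]
        decide
      have c4 : (2 * 2 : ZMod 4) = 0 := by decide
      rw [Nat.cast_mul, c5, ← mul_assoc, c4, zero_mul]

end Counting

section Inversions

open Classical in
/-- Inversion numbers are additive modulo two under composition. -/
lemma exists_inversions_add {β : Type*} {R : β → β → Prop} (hirr : ∀ a, ¬ R a a)
    (hR : ∀ a b, a ≠ b → (R a b ↔ ¬ R b a)) {f g : β → β} (hf : f.Injective) (hg : g.Injective)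
    (X : Finset β) :
    ∃ c : ℕ, ((X ×ˢ X).filter fun z => R z.1 z.2 ∧ R (g (f z.2)) (g (f z.1))).card +
      ((X ×ˢ X).filter fun z => R z.1 z.2 ∧ R (f z.2) (f z.1)).card +
      ((X ×ˢ X).filter fun z => R (f z.1) (f z.2) ∧ R (g (f z.2)) (g (f z.1))).card = 2 * c := by
  have hsplit : ((X ×ˢ X).filter fun z => R (f z.1) (f z.2) ∧ R (g (f z.2)) (g (f z.1))).card =
      ((X ×ˢ X).filter fun z => R z.1 z.2 ∧ R (f z.1) (f z.2) ∧ R (g (f z.2)) (g (f z.1))).card +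
      ((X ×ˢ X).filter fun z =>
        R z.1 z.2 ∧ R (f z.2) (f z.1) ∧ R (g (f z.1)) (g (f z.2))).card := by
    have : ((X ×ˢ X).filter fun z =>
          R z.1 z.2 ∧ R (f z.2) (f z.1) ∧ R (g (f z.1)) (g (f z.2))).card =
        ((X ×ˢ X).filter fun z =>
          R z.2 z.1 ∧ R (f z.1) (f z.2) ∧ R (g (f z.2)) (g (f z.1))).card := by
      refine Finset.card_bij' (fun z _ => z.swap) (fun z _ => z.swap) ?_ ?_ ?_ ?_ <;>
        simp +contextual
    rw [this, ← Finset.card_union_of_disjoint, ← Finset.filter_or]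
    · congr 1
      refine Finset.filter_congr fun z _ => ?_
      rcases eq_or_ne z.1 z.2 with h | h
      · rw [h]
        simp [hirr]
      · have := hR _ _ h
        tauto
    · rw [Finset.disjoint_filter]
      rintro z - ⟨h, -⟩ ⟨h', -⟩
      rcases eq_or_ne z.1 z.2 with e | e
      · exact hirr _ (e ▸ h)
      · exact (hR _ _ e).1 h h'
  rw [hsplit]
  refine ⟨((X ×ˢ X).filter fun z =>
    R z.1 z.2 ∧ (R (f z.2) (f z.1) ∨ R (g (f z.2)) (g (f z.1)))).card, ?_⟩
  simp only [Finset.card_filter, Finset.mul_sum, ← Finset.sum_add_distrib]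
  refine Finset.sum_congr rfl fun z _ => ?_
  rcases eq_or_ne z.1 z.2 with h | h
  · rw [h]
    simp [hirr]
  · have h1 := hR _ _ (hf.ne h)
    have h2 := hR _ _ (hg.ne (hf.ne h))
    by_cases a : R z.1 z.2 <;> by_cases b : R (f z.2) (f z.1) <;>
      by_cases c : R (g (f z.2)) (g (f z.1)) <;> simp [a, b, c, h1, h2]

variable {n : ℕ} {k : Fin n → ℕ}

lemma zLt_iff_not (x y : Cfg k) (h : x ≠ y) : ZLt x y ↔ ¬ ZLt y x := by
  let φ : Cfg k → Lex (∀ d : Fin n, Lex (ℕ → Fin (k d))) := fun z => toLex fun d => toLex (z d)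
  refine ⟨fun h1 h2 => lt_asymm (a := φ x) (b := φ y) h1 h2, fun h' => ?_⟩
  exact ((lt_trichotomy (φ x) (φ y)).resolve_right fun H => H.elim h h')

lemma not_zLt_self (x : Cfg k) : ¬ ZLt x x := by
  let φ : Cfg k → Lex (∀ d : Fin n, Lex (ℕ → Fin (k d))) := fun z => toLex fun d => toLex (z d)
  exact lt_irrefl (φ x)

lemma not_spLt_self (u : Sp n k) : ¬ SpLt u u := by
  simp [SpLt, not_zLt_self]

lemma spLt_iff_not (u v : Sp n k) (h : u ≠ v) : SpLt u v ↔ ¬ SpLt v u := by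
  obtain ⟨x, i⟩ := u
  obtain ⟨y, j⟩ := v
  simp only [SpLt]
  rcases lt_trichotomy i j with hij | rfl | hij
  · simp [hij, hij.asymm, hij.ne']
  · simpa using zLt_iff_not x y fun e => h (by rw [e])
  · simp [hij, hij.asymm, hij.ne']

lemma zLt_shift {d : Fin n} {x y : Cfg k} (h : x d 0 = y d 0) :
    ZLt (Function.update x d fun m => x d (m + 1)) (Function.update y d fun m => y d (m + 1)) ↔
      ZLt x y := by
  refine exists_congr fun e => and_congr ?_ ?_
  · refine forall_congr' fun e' => imp_congr_right fun _ => ?_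
    rcases eq_or_ne e' d with rfl | he
    · simp only [Function.update_self, funext_iff]
      refine ⟨fun H t => ?_, fun H t => H _⟩
      cases t with
      | zero => exact h
      | succ t => exact H t
    · rw [Function.update_of_ne he, Function.update_of_ne he]
  · rcases eq_or_ne e d with rfl | he
    · simp only [Function.update_self]
      constructor
      · rintro ⟨t, ht, hlt⟩
        refine ⟨t + 1, fun t' ht' => ?_, hlt⟩
        cases t' with
        | zero => exact h
        | succ t' => exact ht t' (by omega)
      · rintro ⟨t, ht, hlt⟩
        cases t with
        | zero => exact absurd h hlt.ne
        | succ t => exact ⟨t, fun t' ht' => ht _ (by omega), hlt⟩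
    · rw [Function.update_of_ne he, Function.update_of_ne he]

variable {g : Equiv.Perm (Sp n k)} {i : ℕ} {d : Fin n}

lemma spLt_flip_split (hg : ∀ x, g x = sMap k i d x) (u v : Sp n k) :
    (SpLt u v ∧ SpLt (g v) (g u)) ↔
      (u.2 = i ∧ v.2 = i ∧ (ZLt u.1 v.1 ∧ v.1 d 0 < u.1 d 0)) := by
  obtain ⟨x, a⟩ := u
  obtain ⟨y, b⟩ := v
  have hx := (x d 0).2
  have hy := (y d 0).2
  rw [hg, hg]
  by_cases hab : a = i ∧ b = i
  · obtain ⟨rfl, rfl⟩ := hab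
    simp only [sMap, SpLt, lt_irrefl, if_false, if_true, true_and, false_or]
    refine and_congr_right fun hxy => ?_
    rw [← Fin.val_fin_lt]
    constructor
    · rintro (h | ⟨h, h'⟩)
      · omega
      · rw [zLt_shift (Fin.ext (by omega))] at h'
        rcases eq_or_ne x y with rfl | hne
        · exact absurd hxy (not_zLt_self x)
        · exact absurd h' ((zLt_iff_not x y hne).1 hxy)
    · intro h
      left
      omega
  · have : ¬ (a = i ∧ b = i ∧ (ZLt x y ∧ y d 0 < x d 0)) := by tauto
    simp only [this, iff_false]
    rintro ⟨h | ⟨h, h'⟩, H⟩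
    · simp only [sMap, SpLt] at h H
      split_ifs at H <;> simp only at H <;> omega
    · simp only at h h'
      subst h
      have ha : a ≠ i := fun e => hab ⟨e, e⟩
      rcases eq_or_ne x y with rfl | hne
      · exact not_zLt_self x h'
      · have := (zLt_iff_not x y hne).1 h'
        simp only [sMap, SpLt] at H
        split_ifs at H <;> simp_all

lemma spLt_flip_swap (hg : ∀ x, g x = tMap k i x) (u v : Sp n k) :
    (SpLt u v ∧ SpLt (g v) (g u)) ↔ (u.2 = i ∧ v.2 = i + 1 ∧ True) := by
  obtain ⟨x, a⟩ := u
  obtain ⟨y, b⟩ := v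
  rw [hg, hg]
  constructor
  · rintro ⟨h | ⟨h, h'⟩, H⟩
    · simp only [tMap, SpLt] at h H
      split_ifs at H <;> simp only at H <;> simp only [and_true] <;> omega
    · simp only at h h'
      subst h
      rcases eq_or_ne x y with rfl | hne
      · exact absurd h' (not_zLt_self x)
      · have := (zLt_iff_not x y hne).1 h'
        simp only [tMap, SpLt] at H
        split_ifs at H <;> simp_all
  · rintro ⟨h, h', -⟩
    simp only at h h'
    subst h h'
    simp [SpLt, tMap]

end Inversions

section Value

variable {n : ℕ} {k : Fin n → ℕ} [∀ d, NeZero (k d)] {d₀ d₁ : Fin n}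

/-- The contribution of a point lying in a brick of depth `a`. -/
def weight (d₀ d₁ : Fin n) (a : Fin n → ℕ) : ZMod 4 :=
  ((a d₀ % 2 : ℕ) : ZMod 4) * (-1) ^ (a d₀ + a d₁)

open Classical in
/-- Twice the inversion number of `m` on a box, corrected by the weights of the bricks. -/
noncomputable def value (d₀ d₁ : Fin n) (X : Finset (Sp n k)) (m : Equiv.Perm (Sp n k))
    (p : ℕ → Fin n → ℕ) : ZMod 4 :=
  2 * (((X ×ˢ X).filter fun z => SpLt z.1 z.2 ∧ SpLt (m z.2) (m z.1)).card : ZMod 4) -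
    ∑ x ∈ X, weight d₀ d₁ (p (m x).2)

omit [∀ d, NeZero (k d)] in
lemma value_one (X : Finset (Sp n k)) : value d₀ d₁ X 1 (fun _ _ => 0) = 0 := by
  classical
  rw [value, Finset.filter_false_of_mem]
  · simp [weight]
  · rintro z - ⟨h, h'⟩
    rcases eq_or_ne z.1 z.2 with e | e
    · exact not_spLt_self _ (e ▸ h)
    · exact (spLt_iff_not _ _ e).1 h h'

omit [∀ d, NeZero (k d)] in
open Classical in
lemma two_mul_inversions_mul (X : Finset (Sp n k)) (g m : Equiv.Perm (Sp n k)) :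
    2 * (((X ×ˢ X).filter fun z =>
        SpLt z.1 z.2 ∧ SpLt ((g * m) z.2) ((g * m) z.1)).card : ZMod 4) =
      2 * (((X ×ˢ X).filter fun z => SpLt z.1 z.2 ∧ SpLt (m z.2) (m z.1)).card : ZMod 4) +
      2 * (((X ×ˢ X).filter fun z =>
        SpLt (m z.1) (m z.2) ∧ SpLt (g (m z.2)) (g (m z.1))).card : ZMod 4) := by
  obtain ⟨c, hc⟩ := exists_inversions_add (R := SpLt) not_spLt_self spLt_iff_not m.injective
    g.injective X
  have key : ∀ A B C : ℕ, A + B + C = 2 * c → (2 * A : ZMod 4) = 2 * B + 2 * C := by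
    intro A B C h
    have := congrArg (Nat.cast : ℕ → ZMod 4) h
    push_cast at this
    have h4 : (4 : ZMod 4) = 0 := by decide
    linear_combination 2 * this - (B + C - c : ZMod 4) * h4
  exact key _ _ _ hc

variable {g m : Equiv.Perm (Sp n k)} {p : ℕ → Fin n → ℕ} {J L N i : ℕ}

lemma value_split (h₀ : (d₀ : ℕ) = 0) (h₁ : (d₁ : ℕ) = 1) (hk₀ : k d₀ = 3)
    (hk₁ : k d₁ = 3) (hk : ∀ d, d ≠ d₀ → d ≠ d₁ → k d = 5) {d : Fin n}
    (hg : ∀ x, g x = sMap k i d x) (hp : IsBrickMap m p) (hm : IsShiftFrom m J L) (hi : i < L)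
    (hN : ∀ e, p i e + 1 ≤ N) (heven : Even N) :
    value d₀ d₁ (box k N J) (g * m) (splitDepth k i d p) =
      value d₀ d₁ (box k N J) m p + if d = d₀ then 1 else 0 := by
  classical
  have h01 : d₀ ≠ d₁ := by
    rintro rfl
    omega
  have hN' : ∀ e, p i e ≤ N := fun e => by have := hN e; omega
  have hflip := two_mul_splitInv h₀ h₁ hk₀ hk₁ hk (fun e => N - p i e) d
    (by have := hN d; omega)
  have hpair := card_filter_label_pair hp hm hi hN' hi hN'
    (fun x y => ZLt x y ∧ y d 0 < x d 0)
  simp only [← spLt_flip_split hg] at hpair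
  have hinv : splitInv k (fun e => N - p i e) d = ((box k N J ×ˢ box k N J).filter fun z =>
      SpLt (m z.1) (m z.2) ∧ SpLt (g (m z.2)) (g (m z.1))).card := by
    rw [splitInv]
    convert hpair.symm
  rw [hinv] at hflip
  have hfib := card_filter_label hp hm hi hN'
  apply_fun (Nat.cast : ℕ → ZMod 4) at hfib
  rw [card_grid_cast h01 hk₀ hk₁ hk] at hfib
  rw [pow_add, neg_one_pow_sub_of_even heven (hN' _), neg_one_pow_sub_of_even heven (hN' _)]
    at hfib
  simp only [neg_one_pow_sub_of_even heven (hN' _)] at hflip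
  have hsum : ∑ x ∈ box k N J, weight d₀ d₁ (splitDepth k i d p ((g * m) x).2) =
      ∑ x ∈ box k N J, weight d₀ d₁ (p (m x).2) +
        (((box k N J).filter fun x => (m x).2 = i).card : ZMod 4) *
          (weight d₀ d₁ (Function.update (p i) d (p i d + 1)) - weight d₀ d₁ (p i)) := by
    rw [← nsmul_eq_mul, ← Finset.sum_const, Finset.sum_filter, ← Finset.sum_add_distrib]
    refine Finset.sum_congr rfl fun x _ => ?_
    rw [Equiv.Perm.mul_apply, splitDepth_apply (Nat.one_le_iff_ne_zero.2 (NeZero.ne _)) hg]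
    split_ifs with h
    · rw [h]
      ring
    · ring
  rw [value, two_mul_inversions_mul, hflip, hsum, hfib, value]
  rw [add_sub_add_comm]
  congr 1
  have hpar : ((-1 : ZMod 4) ^ p i d₀ = 1 ∧ p i d₀ % 2 = 0 ∧ (p i d₀ + 1) % 2 = 1) ∨
      ((-1 : ZMod 4) ^ p i d₀ = -1 ∧ p i d₀ % 2 = 1 ∧ (p i d₀ + 1) % 2 = 0) := by
    rcases Nat.even_or_odd (p i d₀) with h | h
    · exact Or.inl ⟨h.neg_one_pow, by have := Nat.even_iff.1 h; omega,
        by have := Nat.even_iff.1 h; omega⟩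
    · exact Or.inr ⟨h.neg_one_pow, by have := Nat.odd_iff.1 h; omega,
        by have := Nat.odd_iff.1 h; omega⟩
  by_cases e0 : d = d₀
  · subst e0
    simp only [weight, Function.update_self, Function.update_of_ne h01.symm, if_pos, if_neg h01,
      pow_add, pow_one]
    rcases neg_one_pow_eq_or (ZMod 4) (p i d₁) with e | e <;>
      rcases hpar with ⟨h1, h2, h3⟩ | ⟨h1, h2, h3⟩ <;> rw [e, h1, h2, h3] <;> decide
  · by_cases e1 : d = d₁
    · subst e1
      simp only [weight, Function.update_self, Function.update_of_ne h01, if_pos, if_neg e0,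
        pow_add, pow_one]
      rcases neg_one_pow_eq_or (ZMod 4) (p i d) with e | e <;>
        rcases hpar with ⟨h1, h2, h3⟩ | ⟨h1, h2, h3⟩ <;> rw [e, h1, h2] <;> decide
    · simp [weight, Function.update_of_ne (Ne.symm e0), Function.update_of_ne (Ne.symm e1), e0, e1]

lemma value_swap (h01 : d₀ ≠ d₁) (hk₀ : k d₀ = 3)
    (hk₁ : k d₁ = 3) (hk : ∀ d, d ≠ d₀ → d ≠ d₁ → k d = 5)
    (hg : ∀ x, g x = tMap k i x) (hp : IsBrickMap m p) (hm : IsShiftFrom m J L) (hi : i + 1 < L)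
    (hN : ∀ l e, p l e ≤ N) :
    value d₀ d₁ (box k N J) (g * m) (fun l => p (Equiv.swap i (i + 1) l)) =
      value d₀ d₁ (box k N J) m p + 2 := by
  classical
  have hflip := card_filter_label_pair hp hm (by omega : i < L) (hN i) hi (hN (i + 1))
    (fun _ _ => True)
  simp only [← spLt_flip_swap hg, Finset.filter_true, Finset.card_product] at hflip
  apply_fun (Nat.cast : ℕ → ZMod 4) at hflip
  rw [Nat.cast_mul, card_grid_cast h01 hk₀ hk₁ hk, card_grid_cast h01 hk₀ hk₁ hk, ← pow_add]
    at hflip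
  rw [value, two_mul_inversions_mul, hflip, value]
  have hsum : ∑ x ∈ box k N J, weight d₀ d₁ (p (Equiv.swap i (i + 1) ((g * m) x).2)) =
      ∑ x ∈ box k N J, weight d₀ d₁ (p (m x).2) := by
    refine Finset.sum_congr rfl fun x _ => ?_
    rw [Equiv.Perm.mul_apply, swap_apply hg, Equiv.swap_apply_self]
  rw [hsum, add_sub_right_comm]
  congr 1
  rcases neg_one_pow_eq_or (ZMod 4) (N - p i d₀ + (N - p i d₁) +
    (N - p (i + 1) d₀ + (N - p (i + 1) d₁))) with e | e <;> rw [e] <;> decide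

end Value

section Ore

/-- In a group, a submonoid with common left multiples has a group of left fractions. -/
lemma exists_mul_mem_of_mem_closure {G : Type*} [Group G] {M : Submonoid G}
    (hM : ∀ a ∈ M, ∀ b ∈ M, ∃ c ∈ M, ∃ d ∈ M, c * a = d * b) {x : G}
    (hx : x ∈ Subgroup.closure (M : Set G)) : ∃ a ∈ M, a * x ∈ M := by
  induction hx using Subgroup.closure_induction with
  | mem x hx => exact ⟨1, M.one_mem, by simpa using hx⟩
  | one => exact ⟨1, M.one_mem, by simp⟩
  | mul x y _ _ ihx ihy =>
    obtain ⟨a, ha, hax⟩ := ihx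
    obtain ⟨b, hb, hby⟩ := ihy
    obtain ⟨c, hc, d, hd, h⟩ := hM _ hax _ hb
    refine ⟨c * a, M.mul_mem hc ha, ?_⟩
    have : c * a * (x * y) = d * (b * y) := by
      rw [← mul_assoc, mul_assoc c, h, mul_assoc]
    rw [this]
    exact M.mul_mem hd hby
  | inv x _ ihx =>
    obtain ⟨a, ha, hax⟩ := ihx
    exact ⟨a * x, hax, by simpa using ha⟩

lemma mem_closure_swap_of_fixes (L : ℕ) (π : Equiv.Perm ℕ) (h : ∀ l, L ≤ l → π l = l) :
    π ∈ Submonoid.closure (Set.range fun i : ℕ => Equiv.swap i (i + 1)) := by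
  induction L generalizing π with
  | zero =>
    have : π = 1 := Equiv.ext fun l => h l (Nat.zero_le l)
    rw [this]
    exact Submonoid.one_mem _
  | succ L ih =>
    have hle : π L ≤ L := by
      by_contra! hlt
      have := π.injective (h _ hlt)
      omega
    obtain ⟨r, hr⟩ := Nat.exists_eq_add_of_le hle
    clear hle
    induction r generalizing π with
    | zero =>
      refine ih π fun l hl => ?_
      rcases hl.eq_or_lt with rfl | hl
      · exact hr.symm
      · exact h l hl
    | succ r ihr =>
      set τ := Equiv.swap (π L) (π L + 1) with hτ
      have hmem : τ * π ∈ Submonoid.closure (Set.range fun i : ℕ => Equiv.swap i (i + 1)) := by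
        refine ihr (τ * π) (fun l hl => ?_) ?_
        · rw [Equiv.Perm.mul_apply, h l hl, hτ, Equiv.swap_apply_of_ne_of_ne] <;> omega
        · rw [Equiv.Perm.mul_apply, hτ, Equiv.swap_apply_left]
          omega
      have hπ : π = τ * (τ * π) := by
        rw [← mul_assoc, hτ, Equiv.swap_mul_self, one_mul]
      rw [hπ]
      exact Submonoid.mul_mem _ (Submonoid.subset_closure ⟨π L, rfl⟩) hmem

end Ore

section Graph

variable {n : ℕ} {k : Fin n → ℕ} [∀ d, NeZero (k d)] {d₀ d₁ : Fin n}

/-- The generators of `W(n,k)`, paired with their prescribed images in `ℤ/4ℤ`. -/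
def valuedGens (d₀ : Fin n) (s : ℕ → Fin n → Equiv.Perm (Sp n k))
    (t : ℕ → Equiv.Perm (Sp n k)) : Set (Equiv.Perm (Sp n k) × Multiplicative (ZMod 4)) :=
  {x | ∃ i d, x = (s i d, Multiplicative.ofAdd (if d = d₀ then 1 else 0))} ∪
    {x | ∃ i, x = (t i, Multiplicative.ofAdd 2)}

variable {s : ℕ → Fin n → Equiv.Perm (Sp n k)} {t : ℕ → Equiv.Perm (Sp n k)}

omit [∀ d, NeZero (k d)] in
lemma splitDepth_le {p : ℕ → Fin n → ℕ} {N L i : ℕ} {d : Fin n} (hi : i < L)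
    (hp : ∀ l < L, ∀ e, p l e ≤ N) (hd : p i d < N) {l : ℕ} (hl : l < L + (k d - 1)) (e : Fin n) :
    splitDepth k i d p l e ≤ N := by
  rw [splitDepth]
  split_ifs with h1 h2
  · exact hp l (h1.trans hi) e
  · rcases eq_or_ne e d with rfl | he
    · rw [Function.update_self]
      omega
    · rw [Function.update_of_ne he]
      exact hp i hi e
  · exact hp _ (by omega) e

lemma exists_value_eq (hs : ∀ i d x, s i d x = sMap k i d x) (ht : ∀ i x, t i x = tMap k i x)
    (h₀ : (d₀ : ℕ) = 0) (h₁ : (d₁ : ℕ) = 1) (hk₀ : k d₀ = 3) (hk₁ : k d₁ = 3)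
    (hk : ∀ d, d ≠ d₀ → d ≠ d₁ → k d = 5) {x : Equiv.Perm (Sp n k) × Multiplicative (ZMod 4)}
    (hx : x ∈ Submonoid.closure (valuedGens d₀ s t)) :
    ∃ (p : ℕ → Fin n → ℕ) (N₀ J₀ L₀ : ℕ), IsBrickMap x.1 p ∧ (∀ l e, p l e ≤ N₀) ∧
      IsShiftFrom x.1 J₀ L₀ ∧ ∀ N J, Even N → N₀ ≤ N → J₀ ≤ J →
        value d₀ d₁ (box k N J) x.1 p = x.2.toAdd := by
  induction hx using Submonoid.closure_induction_left with
  | one =>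
    exact ⟨fun _ _ => 0, 0, 0, 0, isBrickMap_one, by simp, fun _ _ => rfl,
      fun N J _ _ _ => value_one _⟩
  | mul_left x hx y hy ih =>
    obtain ⟨p, N₀, J₀, L₀, hp, hN, hL, hv⟩ := ih
    have hshift : ∀ J, J₀ ≤ J → IsShiftFrom y.1 J (L₀ + (J - J₀)) := by
      intro J hJ
      have := hL.mono (J - J₀)
      rwa [Nat.add_sub_cancel' hJ] at this
    rcases hx with ⟨i, d, rfl⟩ | ⟨i, rfl⟩
    · refine ⟨splitDepth k i d p, N₀ + 1, J₀ + (i + 1), L₀ + (i + 1) + (k d - 1),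
        hp.split (Nat.one_le_iff_ne_zero.2 (NeZero.ne _)) (hs i d), fun l e => ?_,
        (hL.mono (i + 1)).split (hs i d) (by omega), fun N J hev hNN hJ => ?_⟩
      · have hN' : ∀ l e, p l e ≤ N₀ + 1 := fun l e => (hN l e).trans (by omega)
        exact splitDepth_le (L := i + l + 1) (by omega) (fun l _ => hN' l)
          (Nat.lt_succ_of_le (hN i d)) (by omega) e
      · rw [Prod.fst_mul, value_split h₀ h₁ hk₀ hk₁ hk (hs i d) hp (hshift J (by omega))
          (by omega) (fun e => by have := hN i e; omega) hev,
          hv N J hev (by omega) (by omega), Prod.snd_mul, toAdd_mul, add_comm]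
        rfl
    · refine ⟨fun l => p (Equiv.swap i (i + 1) l), N₀, J₀ + (i + 2), L₀ + (i + 2),
        hp.swap (ht i), fun l e => hN _ e, (hL.mono (i + 2)).swap (ht i) (by omega),
        fun N J hev hNN hJ => ?_⟩
      have h01 : d₀ ≠ d₁ := by
        rintro rfl
        omega
      rw [Prod.fst_mul, value_swap h01 hk₀ hk₁ hk (ht i) hp (hshift J (by omega))
          (by omega) (fun l e => (hN l e).trans hNN),
          hv N J hev (by omega) (by omega), Prod.snd_mul, toAdd_mul, add_comm]
      rfl

lemma snd_eq_of_fst_eq (hs : ∀ i d x, s i d x = sMap k i d x) (ht : ∀ i x, t i x = tMap k i x)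
    (h₀ : (d₀ : ℕ) = 0) (h₁ : (d₁ : ℕ) = 1) (hk₀ : k d₀ = 3) (hk₁ : k d₁ = 3)
    (hk : ∀ d, d ≠ d₀ → d ≠ d₁ → k d = 5) {x y : Equiv.Perm (Sp n k) × Multiplicative (ZMod 4)}
    (hx : x ∈ Submonoid.closure (valuedGens d₀ s t))
    (hy : y ∈ Submonoid.closure (valuedGens d₀ s t)) (h : x.1 = y.1) : x = y := by
  obtain ⟨p, N, J, L, hp, -, -, hv⟩ := exists_value_eq hs ht h₀ h₁ hk₀ hk₁ hk hx
  obtain ⟨p', N', J', L', hp', -, -, hv'⟩ := exists_value_eq hs ht h₀ h₁ hk₀ hk₁ hk hy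
  have hk2 : ∀ d, 2 ≤ k d := by
    intro d
    rcases eq_or_ne d d₀ with rfl | h0
    · omega
    · rcases eq_or_ne d d₁ with rfl | h1
      · omega
      · rw [hk d h0 h1]
        norm_num
  obtain rfl : p = p' := (h ▸ hp).unique hk2 hp'
  refine Prod.ext h (Multiplicative.toAdd.injective ?_)
  rw [← hv (2 * (N + N')) (J + J') (even_two_mul _) (by omega) (by omega),
    ← hv' (2 * (N + N')) (J + J') (even_two_mul _) (by omega) (by omega), h]

/-- Splitting bricks one after the other, a brick map can be made uniform of any depth that is
large enough. -/
lemma exists_uniform_refinement (hs : ∀ i d x, s i d x = sMap k i d x) (N J : ℕ)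
    {m : Equiv.Perm (Sp n k)} {p : ℕ → Fin n → ℕ} {L : ℕ} (hp : IsBrickMap m p)
    (hm : IsShiftFrom m J L) (hN : ∀ l < L, ∀ e, p l e ≤ N) :
    ∃ c ∈ Submonoid.closure (valuedGens d₀ s t), ∃ (p' : ℕ → Fin n → ℕ) (L' : ℕ),
      IsBrickMap (c.1 * m) p' ∧ IsShiftFrom (c.1 * m) J L' ∧ ∀ l < L', ∀ e, p' l e = N := by
  induction hμ : ∑ x ∈ box k N J, ∑ e, (N - p (m x).2 e) using Nat.strong_induction_on
    generalizing m p L with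
  | _ μ ih =>
  by_cases hall : ∀ l < L, ∀ e, p l e = N
  · exact ⟨1, Submonoid.one_mem _, p, L, hp, hm, hall⟩
  push Not at hall
  obtain ⟨l, hl, d, hne⟩ := hall
  have hlt : p l d < N := lt_of_le_of_ne (hN l hl d) hne
  have hd : 1 ≤ k d := Nat.one_le_iff_ne_zero.2 (NeZero.ne _)
  have hdec : ∑ x ∈ box k N J, ∑ e, (N - splitDepth k l d p ((s l d * m) x).2 e) < μ := by
    rw [← hμ]
    have key : ∀ x e, splitDepth k l d p ((s l d * m) x).2 e =
        if (m x).2 = l ∧ e = d then p l d + 1 else p (m x).2 e := by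
      intro x e
      rw [Equiv.Perm.mul_apply, splitDepth_apply hd (hs l d)]
      by_cases h : (m x).2 = l
      · rcases eq_or_ne e d with rfl | he
        · simp [h]
        · simp [h, he]
      · simp [h]
    simp only [key]
    have hle : ∀ x e, N - (if (m x).2 = l ∧ e = d then p l d + 1 else p (m x).2 e) ≤
        N - p (m x).2 e := by
      intro x e
      split_ifs with h
      · rw [h.1, h.2]
        omega
      · exact le_rfl
    refine Finset.sum_lt_sum (fun x _ => Finset.sum_le_sum fun e _ => hle x e)
      ⟨m.symm (fun _ _ => 0, l), ?_, ?_⟩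
    · rw [symm_mem_box hp hm hl (hN l hl), mem_grid]
      intros
      rfl
    · refine Finset.sum_lt_sum (fun e _ => hle _ e) ⟨d, Finset.mem_univ d, ?_⟩
      simp only [Equiv.apply_symm_apply, and_self, if_true]
      omega
  obtain ⟨c, hc, p', L', h1, h2, h3⟩ := ih _ hdec (hp.split hd (hs l d)) (hm.split (hs l d) hl)
    (fun l' hl' e => splitDepth_le hl hN hlt hl' e) rfl
  refine ⟨c * (s l d, Multiplicative.ofAdd (if d = d₀ then 1 else 0)),
    Submonoid.mul_mem _ hc (Submonoid.subset_closure (Or.inl ⟨l, d, rfl⟩)), p', L', ?_, ?_, h3⟩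
  · rwa [Prod.fst_mul, mul_assoc]
  · rwa [Prod.fst_mul, mul_assoc]

/-- Two brick maps that are uniform of the same depth differ by a map of the copies. -/
lemma exists_label_of_uniform {m m' : Equiv.Perm (Sp n k)} {p p' : ℕ → Fin n → ℕ} {N J L L' : ℕ}
    (hp : IsBrickMap m p) (hp' : IsBrickMap m' p') (hm : IsShiftFrom m J L)
    (hm' : IsShiftFrom m' J L') (hN : ∀ l < L, ∀ e, p l e = N) (hN' : ∀ l < L', ∀ e, p' l e = N)
    {l : ℕ} (hl : l < L) : ∃ l' < L', ∀ z, m' (m.symm (z, l)) = (z, l') := by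
  obtain ⟨j, w, hw⟩ := hp l
  have hJ := (hm.symm_lt_iff (fun _ _ => 0) l).2 hl
  obtain ⟨⟨y, l'⟩, hy⟩ : ∃ v, m' (m.symm (fun _ _ => 0, l)) = v := ⟨_, rfl⟩
  rw [← Equiv.eq_symm_apply] at hy
  have hlt : l' < L' := by rwa [← hm'.symm_lt_iff y, ← hy]
  refine ⟨l', hlt, fun z => ?_⟩
  obtain ⟨j', w', hw'⟩ := hp' l'
  rw [hw, hw', Prod.mk.injEq] at hy
  obtain ⟨hpre, rfl⟩ := hy
  rw [← Equiv.eq_symm_apply, hw, hw']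
  refine Prod.ext ?_ rfl
  funext e r
  have := congrFun (congrFun hpre e) r
  simp only [pre, hN l hl, hN' l' hlt] at this ⊢
  split_ifs at this ⊢ with h
  · exact this
  · rfl

omit [∀ d, NeZero (k d)] in
lemma exists_prodCongr_mem (ht : ∀ i x, t i x = tMap k i x) {π : Equiv.Perm ℕ}
    (hπ : π ∈ Submonoid.closure (Set.range fun i : ℕ => Equiv.swap i (i + 1))) :
    ∃ v, ((Equiv.refl (Cfg k)).prodCongr π, v) ∈ Submonoid.closure (valuedGens d₀ s t) := by
  induction hπ using Submonoid.closure_induction with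
  | mem π hπ =>
    obtain ⟨i, rfl⟩ := hπ
    refine ⟨Multiplicative.ofAdd 2, Submonoid.subset_closure (Or.inr ⟨i, ?_⟩)⟩
    refine Prod.ext (Equiv.ext fun x => ?_) rfl
    rw [swap_apply (ht i)]
    rfl
  | one => exact ⟨1, Submonoid.one_mem _⟩
  | mul π π' _ _ ih ih' =>
    obtain ⟨v, hv⟩ := ih
    obtain ⟨v', hv'⟩ := ih'
    exact ⟨v * v', Submonoid.mul_mem _ hv hv'⟩

lemma exists_common_multiple (hs : ∀ i d x, s i d x = sMap k i d x)
    (ht : ∀ i x, t i x = tMap k i x)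
    (h₀ : (d₀ : ℕ) = 0) (h₁ : (d₁ : ℕ) = 1) (hk₀ : k d₀ = 3) (hk₁ : k d₁ = 3)
    (hk : ∀ d, d ≠ d₀ → d ≠ d₁ → k d = 5) {a b : Equiv.Perm (Sp n k) × Multiplicative (ZMod 4)}
    (ha : a ∈ Submonoid.closure (valuedGens d₀ s t))
    (hb : b ∈ Submonoid.closure (valuedGens d₀ s t)) :
    ∃ c ∈ Submonoid.closure (valuedGens d₀ s t), ∃ d ∈ Submonoid.closure (valuedGens d₀ s t),
      c * a = d * b := by
  obtain ⟨p, N, J, L, hp, hN, hm, -⟩ := exists_value_eq hs ht h₀ h₁ hk₀ hk₁ hk ha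
  obtain ⟨p', N', J', L', hp', hN', hm', -⟩ := exists_value_eq hs ht h₀ h₁ hk₀ hk₁ hk hb
  have hm'' := hm'.mono J
  rw [add_comm J' J] at hm''
  obtain ⟨c, hc, q, K, hq, hK, hqN⟩ := exists_uniform_refinement (d₀ := d₀) (t := t) hs (N + N')
    (J + J') hp (hm.mono J') (fun l _ e => (hN l e).trans (by omega))
  obtain ⟨d, hd, q', K', hq', hK', hqN'⟩ := exists_uniform_refinement (d₀ := d₀) (t := t) hs
    (N + N') (J + J') hp' hm'' (fun l _ e => (hN' l e).trans (by omega))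
  set m := c.1 * a.1
  set m' := d.1 * b.1
  have hlab : ∀ l, ∃ l', ∀ z, m' (m.symm (z, l)) = (z, l') := by
    intro l
    rcases lt_or_ge l K with hl | hl
    · obtain ⟨l', -, h⟩ := exists_label_of_uniform hq hq' hK hK' hqN hqN' hl
      exact ⟨l', h⟩
    · obtain ⟨j, rfl⟩ := Nat.exists_eq_add_of_le hl
      exact ⟨K' + j, fun z => by rw [← hK z j, Equiv.symm_apply_apply, hK' z j]⟩
  have hlab' : ∀ l, ∃ l', ∀ z, m (m'.symm (z, l)) = (z, l') := by
    intro l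
    rcases lt_or_ge l K' with hl | hl
    · obtain ⟨l', -, h⟩ := exists_label_of_uniform hq' hq hK' hK hqN' hqN hl
      exact ⟨l', h⟩
    · obtain ⟨j, rfl⟩ := Nat.exists_eq_add_of_le hl
      exact ⟨K + j, fun z => by rw [← hK' z j, Equiv.symm_apply_apply, hK z j]⟩
  choose f hf using hlab
  choose f' hf' using hlab'
  have hff' : ∀ l, f' (f l) = l := by
    intro l
    have := hf' (f l) (fun _ _ => 0)
    rw [← hf, Equiv.symm_apply_apply, Equiv.apply_symm_apply, Prod.mk.injEq] at this
    exact this.2.symm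
  have hf'f : ∀ l, f (f' l) = l := by
    intro l
    have := hf (f' l) (fun _ _ => 0)
    rw [← hf', Equiv.symm_apply_apply, Equiv.apply_symm_apply, Prod.mk.injEq] at this
    exact this.2.symm
  let π : Equiv.Perm ℕ := ⟨f, f', hff', hf'f⟩
  have hlt : ∀ l < K, f l < K' := by
    intro l hl
    obtain ⟨l', hl', h⟩ := exists_label_of_uniform hq hq' hK hK' hqN hqN' hl
    have := (hf l (fun _ _ => 0)).symm.trans (h _)
    rw [Prod.mk.injEq] at this
    rwa [this.2]
  have hlt' : ∀ l < K', f' l < K := by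
    intro l hl
    obtain ⟨l', hl', h⟩ := exists_label_of_uniform hq' hq hK' hK hqN' hqN hl
    have := (hf' l (fun _ _ => 0)).symm.trans (h _)
    rw [Prod.mk.injEq] at this
    rwa [this.2]
  obtain rfl : K = K' := by
    have := Finset.card_bij' (s := Finset.range K) (t := Finset.range K') (fun l _ => f l)
      (fun l _ => f' l) (by simpa using hlt) (by simpa using hlt') (by simp [hff'])
      (by simp [hf'f])
    simpa using this
  have hfix : ∀ l, K ≤ l → π l = l := by
    intro l hl
    obtain ⟨j, rfl⟩ := Nat.exists_eq_add_of_le hl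
    have := hf (K + j) (fun _ _ => 0)
    rw [← hK _ j, Equiv.symm_apply_apply, hK' _ j, Prod.mk.injEq] at this
    exact this.2.symm
  obtain ⟨v, hv⟩ := exists_prodCongr_mem (d₀ := d₀) (s := s) ht
    (mem_closure_swap_of_fixes K π hfix)
  refine ⟨_, Submonoid.mul_mem _ hv hc, d, hd, ?_⟩
  refine snd_eq_of_fst_eq hs ht h₀ h₁ hk₀ hk₁ hk
    (Submonoid.mul_mem _ (Submonoid.mul_mem _ hv hc) ha) (Submonoid.mul_mem _ hd hb) ?_
  simp only [Prod.fst_mul, mul_assoc]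
  refine Equiv.ext fun x => ?_
  change ((m x).1, f (m x).2) = m' x
  rw [← hf, Prod.mk.eta, Equiv.symm_apply_apply]

/-- The prescribed values on the generators extend to a homomorphism on `W(n,k)`. -/
lemma exists_hom (hs : ∀ i d x, s i d x = sMap k i d x) (ht : ∀ i x, t i x = tMap k i x)
    (h₀ : (d₀ : ℕ) = 0) (h₁ : (d₁ : ℕ) = 1) (hk₀ : k d₀ = 3) (hk₁ : k d₁ = 3)
    (hk : ∀ d, d ≠ d₀ → d ≠ d₁ → k d = 5) :
    ∃ ρ : Subgroup.closure (gens k s t) →* Multiplicative (ZMod 4),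
      ∀ x ∈ valuedGens d₀ s t, ∀ h, ρ ⟨x.1, h⟩ = x.2 := by
  let H := Subgroup.closure (valuedGens d₀ s t)
  let φ : H →* Equiv.Perm (Sp n k) := (MonoidHom.fst _ _).comp H.subtype
  have hφ : Function.Injective φ := by
    rw [injective_iff_map_eq_one]
    rintro ⟨⟨g, v⟩, hx⟩ (rfl : g = 1)
    obtain ⟨a, ha, hb⟩ := exists_mul_mem_of_mem_closure
      (fun a ha b hb => exists_common_multiple hs ht h₀ h₁ hk₀ hk₁ hk ha hb)
      (Subgroup.closure_mono Submonoid.subset_closure hx)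
    have := snd_eq_of_fst_eq hs ht h₀ h₁ hk₀ hk₁ hk hb ha (by simp)
    exact Subtype.ext (mul_eq_left.1 this)
  have hle : Subgroup.closure (gens k s t) ≤ φ.range := by
    rw [Subgroup.closure_le]
    rintro g (⟨i, d, rfl⟩ | ⟨i, rfl⟩)
    · exact ⟨⟨_, Subgroup.subset_closure (Or.inl ⟨i, d, rfl⟩)⟩, rfl⟩
    · exact ⟨⟨_, Subgroup.subset_closure (Or.inr ⟨i, rfl⟩)⟩, rfl⟩
  refine ⟨((MonoidHom.snd _ _).comp H.subtype).comp
    ((MonoidHom.ofInjective hφ).symm.toMonoidHom.comp (Subgroup.inclusion hle)), ?_⟩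
  intro x hx h
  have : (MonoidHom.ofInjective hφ).symm ⟨x.1, hle h⟩ = ⟨x, Subgroup.subset_closure hx⟩ := by
    rw [MulEquiv.symm_apply_eq]
    rfl
  change ((MonoidHom.ofInjective hφ).symm ⟨x.1, hle h⟩).1.2 = x.2
  rw [this]

end Graph

end WGroup

theorem statement10 (n : ℕ) (hn : 2 ≤ n)
    (s : ℕ → Fin n → Equiv.Perm (WGroup.Sp n (kTen n)))
    (t : ℕ → Equiv.Perm (WGroup.Sp n (kTen n)))
    (hs : ∀ i d p, s i d p = WGroup.sMap (kTen n) i d p)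
    (ht : ∀ i p, t i p = WGroup.tMap (kTen n) i p) :
    ∃ ρ : ↥(Subgroup.closure (WGroup.gens (kTen n) s t)) →* Multiplicative (ZMod 4),
      (∀ (i : ℕ) (h : s i ⟨0, by omega⟩ ∈ Subgroup.closure (WGroup.gens (kTen n) s t)),
        ρ ⟨s i ⟨0, by omega⟩, h⟩ = Multiplicative.ofAdd (1 : ZMod 4)) ∧
      (∀ (i : ℕ) (d : Fin n), (d : ℕ) ≠ 0 →
        ∀ h : s i d ∈ Subgroup.closure (WGroup.gens (kTen n) s t),
          ρ ⟨s i d, h⟩ = Multiplicative.ofAdd (0 : ZMod 4)) ∧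
      (∀ (i : ℕ) (h : t i ∈ Subgroup.closure (WGroup.gens (kTen n) s t)),
        ρ ⟨t i, h⟩ = Multiplicative.ofAdd (2 : ZMod 4)) := by
  have : ∀ d, NeZero (kTen n d) := fun d => ⟨by unfold kTen; split_ifs <;> norm_num⟩
  obtain ⟨ρ, hρ⟩ := WGroup.exists_hom (k := kTen n) (d₀ := ⟨0, by omega⟩) (d₁ := ⟨1, by omega⟩)
    hs ht rfl rfl rfl rfl (fun d h0 h1 => if_neg fun hd => by
      rw [Ne, Fin.ext_iff] at h0 h1
      simp only at h0 h1
      omega)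
  refine ⟨ρ, fun i h => ?_, fun i d hd h => ?_, fun i h => ?_⟩
  · simpa using hρ _ (Or.inl ⟨i, ⟨0, by omega⟩, rfl⟩) h
  · have := hρ _ (Or.inl ⟨i, d, rfl⟩) h
    rwa [if_neg fun e => hd (congrArg Fin.val e)] at this
  · exact hρ _ (Or.inr ⟨i, rfl⟩) h
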